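/- Fix s ∈ (0,1/2) and let u(x,y) = Im((x+iy)^s) on the open upper half-plane. Then: (a) u is infinitely differentiable and harmonic on {y > 0}, i.e. ∂²u/∂x² + ∂²u/∂y² = 0 there; (b) for every x > 0, u(x,y) → 0 as y → 0+; (c) for every x < 0, (∂u/∂y − cot(πs)·∂u/∂x)(x,y) → 0 as y → 0+. Consequently, for the constant matrix A = [[1, cot(πs)], [−cot(πs), 1]] (whose skew-symmetric part is constant, so that D_i(a_{ij}D_j u) = Δu), u solves D_i(a_{ij}D_j u) = 0 in the upper half-plane with u = 0 on {x > 0, y = 0} and vanishing conormal derivative a_{ij}D_j u·n_i on {x < 0, y = 0}. -/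

import Mathlib

open Set Filter Complex Topology Real

/-- `u (x,y) = Im ((x + i y)^s)` with the principal branch of the complex power. -/
noncomputable def powIm (s x y : ℝ) : ℝ :=
  (((x : ℂ) + (y : ℂ) * Complex.I) ^ (s : ℂ)).im

theorem slit_aux (x y : ℝ) (hy : 0 < y) : (x : ℂ) + (y : ℂ) * Complex.I ∈ Complex.slitPlane := by
  rw [Complex.mem_slitPlane_iff]
  right
  simpa using hy.ne'

theorem hx_aux (a c : ℂ) (x y : ℝ) (hy : 0 < y) :
    HasDerivAt (fun t : ℝ => (a * ((t : ℂ) + (y : ℂ) * Complex.I) ^ c).im)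
      ((a * c * ((x : ℂ) + (y : ℂ) * Complex.I) ^ (c - 1)).im) x := by
  have h1 : HasDerivAt (fun z : ℂ => z + (y : ℂ) * Complex.I) 1 (x : ℂ) :=
    (hasDerivAt_id (x : ℂ)).add_const _
  have h2 := ((h1.cpow_const (c := c) (slit_aux x y hy)).const_mul a).comp_ofReal
  have h3 := Complex.imCLM.hasFDerivAt.comp_hasDerivAt x h2
  have e : Complex.imCLM (a * (c * ((x : ℂ) + (y : ℂ) * Complex.I) ^ (c - 1) * 1)) =
      (a * c * ((x : ℂ) + (y : ℂ) * Complex.I) ^ (c - 1)).im := by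
    rw [Complex.imCLM_apply]
    congr 1
    ring
  rw [e] at h3
  exact h3

theorem hy_aux (a c : ℂ) (x y : ℝ) (hy : 0 < y) :
    HasDerivAt (fun t : ℝ => (a * ((x : ℂ) + (t : ℂ) * Complex.I) ^ c).im)
      ((a * c * Complex.I * ((x : ℂ) + (y : ℂ) * Complex.I) ^ (c - 1)).im) y := by
  have h1 : HasDerivAt (fun z : ℂ => (x : ℂ) + z * Complex.I) (1 * Complex.I) (y : ℂ) :=
    ((hasDerivAt_id (y : ℂ)).mul_const _).const_add _
  have h2 := ((h1.cpow_const (c := c) (slit_aux x y hy)).const_mul a).comp_ofReal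
  have h3 := Complex.imCLM.hasFDerivAt.comp_hasDerivAt y h2
  have e : Complex.imCLM (a * (c * ((x : ℂ) + (y : ℂ) * Complex.I) ^ (c - 1) * (1 * Complex.I))) =
      (a * c * Complex.I * ((x : ℂ) + (y : ℂ) * Complex.I) ^ (c - 1)).im := by
    rw [Complex.imCLM_apply]
    congr 1
    ring
  rw [e] at h3
  exact h3

theorem dx_aux (s x y : ℝ) (hy : 0 < y) : deriv (fun t : ℝ => powIm s t y) x =
    ((s : ℂ) * ((x : ℂ) + (y : ℂ) * Complex.I) ^ ((s : ℂ) - 1)).im := by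
  have h := (hx_aux 1 s x y hy).deriv
  simpa only [one_mul, powIm] using h

theorem dy_aux (s x y : ℝ) (hy : 0 < y) : deriv (fun t : ℝ => powIm s x t) y =
    ((s : ℂ) * Complex.I * ((x : ℂ) + (y : ℂ) * Complex.I) ^ ((s : ℂ) - 1)).im := by
  have h := (hy_aux 1 s x y hy).deriv
  simpa only [one_mul, powIm] using h

theorem path_aux (x : ℝ) : Tendsto (fun y : ℝ => (x : ℂ) + (y : ℂ) * Complex.I)
    (𝓝[>] 0) (𝓝 (x : ℂ)) := by
  have : Continuous (fun y : ℝ => (x : ℂ) + (y : ℂ) * Complex.I) := by fun_prop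
  have h := this.tendsto 0
  simp only [Complex.ofReal_zero, zero_mul, add_zero] at h
  exact h.mono_left nhdsWithin_le_nhds

theorem lim_neg_aux (c : ℂ) (x : ℝ) (hx : x < 0) :
    Tendsto (fun y : ℝ => ((x : ℂ) + (y : ℂ) * Complex.I) ^ c) (𝓝[>] 0)
      (𝓝 ((x : ℂ) ^ c)) := by
  have hlog : Tendsto (fun y : ℝ => Complex.log ((x : ℂ) + (y : ℂ) * Complex.I)) (𝓝[>] 0)
      (𝓝 (Complex.log (x : ℂ))) := by
    have h0 : ContinuousWithinAt Complex.log {z : ℂ | 0 ≤ z.im} (x : ℂ) :=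
      Complex.continuousWithinAt_log_of_re_neg_of_im_zero (by simpa using hx) (by simp)
    refine h0.tendsto.comp (tendsto_nhdsWithin_iff.2 ⟨path_aux x, ?_⟩)
    filter_upwards [self_mem_nhdsWithin] with y hy
    simpa using (le_of_lt hy : (0 : ℝ) ≤ y)
  have hexp := (Complex.continuous_exp.tendsto _).comp (hlog.mul_const c)
  have hx0 : (x : ℂ) ≠ 0 := by exact_mod_cast hx.ne
  rw [Complex.cpow_def_of_ne_zero hx0]
  refine hexp.congr' ?_
  filter_upwards [self_mem_nhdsWithin] with y hy
  rw [Complex.cpow_def_of_ne_zero (Complex.slitPlane_ne_zero (slit_aux x y hy))]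
  rfl

/-- For `s ∈ (0,1/2)`, the function `u = Im z^s` is smooth and harmonic in the open
upper half-plane, `u → 0` at the positive real axis, and
`∂u/∂y − cot(πs)·∂u/∂x → 0` at the negative real axis; hence `u` solves the
mixed Dirichlet-conormal problem for the operator with coefficient matrix
`[[1, cot(πs)], [−cot(πs), 1]]`. -/
theorem powIm_harmonic_mixed_data (s : ℝ) (hs : s ∈ Set.Ioo (0 : ℝ) (1 / 2)) :
    (ContDiffOn ℝ (⊤ : ℕ∞) (fun p : ℝ × ℝ => powIm s p.1 p.2) {p : ℝ × ℝ | 0 < p.2}) ∧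
    (∀ x y : ℝ, 0 < y →
      iteratedDeriv 2 (fun t : ℝ => powIm s t y) x
        + iteratedDeriv 2 (fun t : ℝ => powIm s x t) y = 0) ∧
    (∀ x : ℝ, 0 < x →
      Tendsto (fun y : ℝ => powIm s x y) (nhdsWithin 0 (Set.Ioi 0)) (nhds 0)) ∧
    (∀ x : ℝ, x < 0 →
      Tendsto
        (fun y : ℝ =>
          deriv (fun t : ℝ => powIm s x t) y
            - Real.cot (Real.pi * s) * deriv (fun t : ℝ => powIm s t y) x)
        (nhdsWithin 0 (Set.Ioi 0)) (nhds 0)) := by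
  obtain ⟨hs0, hs1⟩ := hs
  refine ⟨?_, ?_, ?_, ?_⟩
  · intro p hp
    have hp' : (0 : ℝ) < p.2 := hp
    apply ContDiffAt.contDiffWithinAt
    unfold powIm
    have hg : ContDiffAt ℝ (⊤ : ℕ∞) (fun q : ℝ × ℝ => (q.1 : ℂ) + (q.2 : ℂ) * Complex.I) p := by
      have h1 : ContDiff ℝ (⊤ : ℕ∞) (fun q : ℝ × ℝ => (q.1 : ℂ)) :=
        Complex.ofRealCLM.contDiff.comp contDiff_fst
      have h2 : ContDiff ℝ (⊤ : ℕ∞) (fun q : ℝ × ℝ => (q.2 : ℂ)) :=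
        Complex.ofRealCLM.contDiff.comp contDiff_snd
      exact (h1.add (h2.mul contDiff_const)).contDiffAt
    have hf : ContDiffAt ℝ (⊤ : ℕ∞) (fun z : ℂ => z ^ (s : ℂ))
        ((p.1 : ℂ) + (p.2 : ℂ) * Complex.I) := by
      have ha : AnalyticAt ℂ (fun z : ℂ => z ^ (s : ℂ)) ((p.1 : ℂ) + (p.2 : ℂ) * Complex.I) :=
        analyticAt_id.cpow analyticAt_const (slit_aux p.1 p.2 hp')
      exact ha.contDiffAt.restrict_scalars ℝ
    have hfg : ContDiffAt ℝ (⊤ : ℕ∞) (fun q : ℝ × ℝ =>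
        ((q.1 : ℂ) + (q.2 : ℂ) * Complex.I) ^ (s : ℂ)) p :=
      ContDiffAt.comp (g := fun z : ℂ => z ^ (s : ℂ)) p hf hg
    exact Complex.imCLM.contDiff.contDiffAt.comp p hfg
  · intro x y hy
    simp only [iteratedDeriv_succ, iteratedDeriv_zero]
    have e1 : deriv (fun t : ℝ => powIm s t y) =
        fun t : ℝ => ((s : ℂ) * ((t : ℂ) + (y : ℂ) * Complex.I) ^ ((s : ℂ) - 1)).im :=
      funext fun t => dx_aux s t y hy
    have e2 : deriv (fun t : ℝ => powIm s x t) =ᶠ[𝓝 y]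
        fun t : ℝ => ((s : ℂ) * Complex.I *
          ((x : ℂ) + (t : ℂ) * Complex.I) ^ ((s : ℂ) - 1)).im := by
      filter_upwards [lt_mem_nhds hy] with t ht
      exact dy_aux s x t ht
    rw [e1, e2.deriv_eq, (hx_aux _ _ x y hy).deriv, (hy_aux _ _ x y hy).deriv, ← Complex.add_im]
    have : ∀ w : ℂ, (s : ℂ) * ((s : ℂ) - 1) * w +
        (s : ℂ) * Complex.I * ((s : ℂ) - 1) * Complex.I * w = 0 := by
      intro w
      linear_combination (s : ℂ) * ((s : ℂ) - 1) * w * Complex.I_mul_I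
    rw [this, Complex.zero_im]
  · intro x hx
    have hc : ContinuousAt (fun z : ℂ => z ^ (s : ℂ)) (x : ℂ) :=
      continuousAt_cpow_const (by simpa using hx)
    have h := (Complex.continuous_im.tendsto _).comp (hc.tendsto.comp (path_aux x))
    rw [← Complex.ofReal_cpow hx.le, Complex.ofReal_im] at h
    exact h
  · intro x hx
    have hl := lim_neg_aux ((s : ℂ) - 1) x hx
    have h1 := (Complex.continuous_im.tendsto _).comp (hl.const_mul ((s : ℂ) * Complex.I))
    have h2 := (Complex.continuous_im.tendsto _).comp (hl.const_mul (s : ℂ))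
    have h3 := h1.sub (h2.const_mul (Real.cot (Real.pi * s)))
    have hv : (x : ℂ) ^ ((s : ℂ) - 1) = (((-x) ^ (s - 1) : ℝ) : ℂ) *
        (-((Real.cos (Real.pi * s) : ℝ) + (Real.sin (Real.pi * s) : ℝ) * Complex.I)) := by
      have e := Complex.ofReal_cpow_of_nonpos hx.le ((s : ℂ) - 1)
      rw [e, Complex.ofReal_cpow (by linarith : 0 ≤ -x)]
      push_cast
      congr 1
      rw [← Complex.exp_mul_I, show (Real.pi : ℂ) * Complex.I * ((s : ℂ) - 1) =
        (Real.pi : ℂ) * s * Complex.I - Real.pi * Complex.I by ring, Complex.exp_sub,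
        Complex.exp_pi_mul_I]
      ring
    have hsin : Real.sin (Real.pi * s) ≠ 0 := by
      apply ne_of_gt
      apply Real.sin_pos_of_pos_of_lt_pi
      · positivity
      · nlinarith [Real.pi_pos]
    have hz : ((s : ℂ) * Complex.I * (x : ℂ) ^ ((s : ℂ) - 1)).im - Real.cot (Real.pi * s) *
        ((s : ℂ) * (x : ℂ) ^ ((s : ℂ) - 1)).im = 0 := by
      rw [hv, Real.cot_eq_cos_div_sin]
      generalize Real.sin (Real.pi * s) = S at *
      generalize Real.cos (Real.pi * s) = C at *
      generalize (-x) ^ (s - 1) = R at *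
      simp
      field_simp
      ring
    rw [hz] at h3
    refine h3.congr' ?_
    filter_upwards [self_mem_nhdsWithin] with y hy
    rw [dx_aux s x y hy, dy_aux s x y hy]
    rfl
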